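/- arXiv:1811.10042 — 3 statements merged into one kernel-verified Lean document; each statement's English description precedes it below -/
import Mathlib

section
/- Let n ≥ 2 and let d_1, …, d_n be positive integers with ∑_{i=1}^n 1/d_i < 1. Let −1 = b_1^- < b_1^+ < b_2^- < b_2^+ < ⋯ < b_n^- < b_n^+ = 0 be real numbers with b_i^+ − b_i^- = 1/d_i for each i, let ε_1, …, ε_n ∈ {+1, −1}, and for each i let ψ_i : [−1,0] → [b_i^-, b_i^+] be the affine bijection given by ψ_i(x) = b_i^+ + x/d_i if ε_i = +1 and ψ_i(x) = b_i^- − x/d_i if ε_i = −1. If A is a nonempty compact subset of [−1,0] with A = ⋃_{i=1}^n ψ_i(A), then the Hausdorff dimension of A equals α_{d_1,…,d_n}. -/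
open Set

open scoped NNReal ENNReal

/-- Every set has an open neighbourhood whose diameter to a given positive power is almost as
small as that of the set itself. -/
theorem exists_isOpen_ediam_rpow_le {X : Type*} [PseudoEMetricSpace X] {a : ℝ} (ha : 0 < a)
    (s : Set X) {δ : ℝ≥0∞} (hδ : δ ≠ 0) :
    ∃ u, IsOpen u ∧ s ⊆ u ∧ Metric.ediam u ^ a ≤ Metric.ediam s ^ a + δ := by
  by_cases hs : Metric.ediam s = ∞
  · exact ⟨univ, isOpen_univ, subset_univ s, by simp [hs, ha]⟩
  have hcont : Continuous fun x : ℝ≥0 ↦ (Metric.ediam s + 2 * (x : ℝ≥0∞)) ^ a :=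
    ENNReal.continuous_rpow_const.comp
      (continuous_const.add
        ((ENNReal.continuous_const_mul ENNReal.ofNat_ne_top).comp ENNReal.continuous_coe))
  have hlt : (Metric.ediam s + 2 * ((0 : ℝ≥0) : ℝ≥0∞)) ^ a < Metric.ediam s ^ a + δ := by
    simpa using ENNReal.lt_add_right (ENNReal.rpow_ne_top_of_nonneg ha.le hs) hδ
  have hev := (hcont.tendsto 0).eventually (gt_mem_nhds hlt)
  obtain ⟨x, hx, hx0⟩ :=
    ((hev.filter_mono nhdsWithin_le_nhds).and (self_mem_nhdsWithin (s := Ioi (0 : ℝ≥0)))).exists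
  refine ⟨Metric.thickening x s, Metric.isOpen_thickening,
    Metric.self_subset_thickening (NNReal.coe_pos.2 hx0) s, ?_⟩
  grw [Metric.ediam_thickening_le, hx]

/-- To bound the Hausdorff measure of a compact set from below, it suffices to consider finite
covers. -/
theorem IsCompact.le_hausdorffMeasure_of_forall_finite_cover {X : Type*} [EMetricSpace X]
    [MeasurableSpace X] [BorelSpace X] {a : ℝ} (ha : 0 < a) {A : Set X} (hA : IsCompact A)
    {c : ℝ≥0∞}
    (h : ∀ (s : Finset ℕ) (U : ℕ → Set X), A ⊆ ⋃ j ∈ s, U j →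
      c ≤ ∑ j ∈ s, Metric.ediam (U j) ^ a) :
    c ≤ MeasureTheory.Measure.hausdorffMeasure a A := by
  rw [MeasureTheory.Measure.hausdorffMeasure_apply]
  refine le_iSup₂_of_le ∞ ENNReal.zero_lt_top (le_iInf₂ fun t ht ↦ le_iInf fun _ ↦ ?_)
  have hterm (n : ℕ) :
      ⨆ _ : (t n).Nonempty, Metric.ediam (t n) ^ a = Metric.ediam (t n) ^ a := by
    rcases (t n).eq_empty_or_nonempty with hn | hn
    · simp [hn, ha]
    · simp [hn]
  simp_rw [hterm]
  refine ENNReal.le_of_forall_pos_le_add fun ε hε _ ↦ ?_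
  obtain ⟨δ, hδ, hδsum⟩ :=
    ENNReal.exists_pos_sum_of_countable' (ENNReal.coe_ne_zero.2 hε.ne') ℕ
  choose U hUo htU hU using fun n ↦ exists_isOpen_ediam_rpow_le ha (t n) (hδ n).ne'
  obtain ⟨s, hs⟩ := hA.elim_finite_subcover U hUo (ht.trans (iUnion_mono htU))
  calc c ≤ ∑ j ∈ s, Metric.ediam (U j) ^ a := h s U hs
    _ ≤ ∑' j, Metric.ediam (U j) ^ a := ENNReal.sum_le_tsum s
    _ ≤ ∑' j, (Metric.ediam (t j) ^ a + δ j) := ENNReal.tsum_le_tsum hU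
    _ = ∑' j, Metric.ediam (t j) ^ a + ∑' j, δ j := ENNReal.tsum_add
    _ ≤ ∑' j, Metric.ediam (t j) ^ a + ε := by gcongr

/-- If finitely many maps contracting by at most the ratios `r i` send `A` into `g`-separated parts
of `A`, then every finite cover of `A` has `a`-dimensional size at least `g ^ a`, where `a` is the
similarity dimension. -/
theorem rpow_le_sum_ediam_rpow_of_separated {X ι κ : Type*} [PseudoEMetricSpace X] [Fintype ι]
    [Nontrivial ι] {a : ℝ} (ha : 0 < a) {r : ι → ℝ≥0} (hr : ∀ i, r i ≠ 0)
    (hsum : ∑ i, (r i : ℝ≥0∞) ^ a = 1) {f : ι → X → X}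
    (hf : ∀ i, AntilipschitzWith (r i)⁻¹ (f i)) {A : Set X} (hA : A.Nonempty)
    (hfA : ∀ i, MapsTo (f i) A A) {g : ℝ≥0∞}
    (hg : ∀ i j, i ≠ j → ∀ x ∈ A, ∀ y ∈ A, g ≤ edist (f i x) (f j y))
    (s : Finset κ) (U : κ → Set X) (hU : A ⊆ ⋃ j ∈ s, U j) :
    g ^ a ≤ ∑ j ∈ s, Metric.ediam (U j) ^ a := by
  classical
  induction s using Finset.strongInduction generalizing U with
  | H s ih =>
  by_cases hbig : ∃ j ∈ s, g ≤ Metric.ediam (U j)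
  · obtain ⟨j, hj, hgj⟩ := hbig
    calc g ^ a ≤ Metric.ediam (U j) ^ a := by gcongr
      _ ≤ _ := Finset.single_le_sum (f := fun j ↦ Metric.ediam (U j) ^ a)
        (fun _ _ ↦ zero_le) hj
  push Not at hbig
  let S (i : ι) : Finset κ := s.filter fun j ↦ (U j ∩ f i '' A).Nonempty
  have hdisj : Pairwise fun i i' ↦ Disjoint (S i) (S i') := by
    intro i i' hii
    rw [Finset.disjoint_left]
    intro j hj hj'
    obtain ⟨hjs, _, hx, x, hxA, rfl⟩ := Finset.mem_filter.1 hj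
    obtain ⟨-, _, hy, y, hyA, rfl⟩ := Finset.mem_filter.1 hj'
    exact ((hg i i' hii x hxA y hyA).trans (Metric.edist_le_ediam_of_mem hx hy)).not_gt
      (hbig j hjs)
  have hcover (i : ι) {x : X} (hx : x ∈ A) : ∃ j ∈ S i, f i x ∈ U j := by
    obtain ⟨j, hj, hxj⟩ := mem_iUnion₂.1 (hU (hfA i hx))
    exact ⟨j, Finset.mem_filter.2 ⟨hj, f i x, hxj, x, hx, rfl⟩, hxj⟩
  have hssub (i : ι) : S i ⊂ s := by
    refine (Finset.filter_subset _ _).ssubset_of_ne fun heq ↦ ?_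
    obtain ⟨i', hi'⟩ := exists_ne i
    obtain ⟨x, hx⟩ := hA
    obtain ⟨j, hj, -⟩ := hcover i' hx
    exact Finset.disjoint_left.1 (hdisj hi') hj (heq.ge (Finset.mem_filter.1 hj).1)
  have hpiece (i : ι) : (r i : ℝ≥0∞) ^ a * g ^ a ≤ ∑ j ∈ S i, Metric.ediam (U j) ^ a := by
    have hi := ih (S i) (hssub i) (fun j ↦ f i ⁻¹' U j) fun x hx ↦ by
      obtain ⟨j, hj, hxj⟩ := hcover i hx
      exact mem_iUnion₂.2 ⟨j, hj, hxj⟩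
    grw [hi, Finset.mul_sum]
    refine Finset.sum_le_sum fun j _ ↦ ?_
    rw [← ENNReal.mul_rpow_of_nonneg _ _ ha.le]
    refine ENNReal.rpow_le_rpow ?_ ha.le
    grw [(hf i).ediam_preimage_le, ← mul_assoc, ← ENNReal.coe_mul, mul_inv_cancel₀ (hr i)]
    simp
  calc g ^ a = ∑ i, (r i : ℝ≥0∞) ^ a * g ^ a := by rw [← Finset.sum_mul, hsum, one_mul]
    _ ≤ ∑ i, ∑ j ∈ S i, Metric.ediam (U j) ^ a := Finset.sum_le_sum fun i _ ↦ hpiece i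
    _ = ∑ j ∈ Finset.univ.biUnion S, Metric.ediam (U j) ^ a :=
      (Finset.sum_biUnion fun i _ j _ hij ↦ hdisj hij).symm
    _ ≤ _ := Finset.sum_le_sum_of_subset
      (Finset.biUnion_subset.2 fun i _ ↦ Finset.filter_subset _ _)

/-- A set covered by its images under finitely many Lipschitz maps is covered, at each depth `k`,
by sets indexed by words of length `k` whose diameters are controlled by the Lipschitz constants. -/
theorem exists_cover_of_subset_iUnion_image {X : Type*} [PseudoEMetricSpace X] {n : ℕ} {a : ℝ}
    (ha : 0 ≤ a) {r : Fin n → ℝ≥0} (hsum : ∑ i, (r i : ℝ≥0∞) ^ a = 1) {ρ : ℝ≥0}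
    (hρ : ∀ i, r i ≤ ρ) {f : Fin n → X → X} (hf : ∀ i, LipschitzWith (r i) (f i)) {A : Set X}
    (hA : A ⊆ ⋃ i, f i '' A) (k : ℕ) :
    ∃ t : (Fin k → Fin n) → Set X, A ⊆ ⋃ w, t w ∧
      (∀ w, Metric.ediam (t w) ≤ (ρ : ℝ≥0∞) ^ k * Metric.ediam A) ∧
      ∑ w, Metric.ediam (t w) ^ a ≤ Metric.ediam A ^ a := by
  induction k with
  | zero => exact ⟨fun _ ↦ A, subset_iUnion (fun _ : Fin 0 → Fin n ↦ A) Fin.elim0, by simp, by simp⟩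
  | succ k ih =>
    obtain ⟨t, hcov, hdiam, hle⟩ := ih
    refine ⟨fun w ↦ f (w 0) '' t (Fin.tail w), fun x hx ↦ ?_, fun w ↦ ?_, ?_⟩
    · obtain ⟨i, y, hy, rfl⟩ := mem_iUnion.1 (hA hx)
      obtain ⟨w, hw⟩ := mem_iUnion.1 (hcov hy)
      exact mem_iUnion.2 ⟨Fin.cons i w, y, by simpa using hw, by simp⟩
    · grw [(hf (w 0)).ediam_image_le, hdiam, hρ (w 0), pow_succ', mul_assoc]
    · rw [← (Fin.consEquiv fun _ ↦ Fin n).sum_comp, Fintype.sum_prod_type]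
      calc ∑ i, ∑ w, Metric.ediam (f i '' t w) ^ a
          ≤ ∑ i, ∑ w, (r i : ℝ≥0∞) ^ a * Metric.ediam (t w) ^ a := by
            gcongr with i _ w _
            grw [(hf i).ediam_image_le, ENNReal.mul_rpow_of_nonneg _ _ ha]
        _ = ∑ w, Metric.ediam (t w) ^ a := by
          simp_rw [← Finset.mul_sum]
          rw [← Finset.sum_mul, hsum, one_mul]
        _ ≤ _ := hle

/-- The Hausdorff measure, in the similarity dimension, of a set covered by its images under
finitely many contractions is at most that power of its diameter. -/
theorem hausdorffMeasure_le_ediam_rpow_of_subset_iUnion_image {X : Type*} [EMetricSpace X]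
    [MeasurableSpace X] [BorelSpace X] {n : ℕ} {a : ℝ} (ha : 0 ≤ a) {r : Fin n → ℝ≥0}
    (hsum : ∑ i, (r i : ℝ≥0∞) ^ a = 1) {ρ : ℝ≥0} (hρ1 : ρ < 1) (hρ : ∀ i, r i ≤ ρ)
    {f : Fin n → X → X} (hf : ∀ i, LipschitzWith (r i) (f i)) {A : Set X}
    (hdiam : Metric.ediam A ≠ ∞) (hA : A ⊆ ⋃ i, f i '' A) :
    MeasureTheory.Measure.hausdorffMeasure a A ≤ Metric.ediam A ^ a := by
  choose t hcov ht hle using exists_cover_of_subset_iUnion_image ha hsum hρ hf hA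
  have htend : Filter.Tendsto (fun k : ℕ ↦ (ρ : ℝ≥0∞) ^ k * Metric.ediam A) Filter.atTop
      (nhds 0) := by
    simpa using ENNReal.Tendsto.mul_const
      (ENNReal.tendsto_pow_atTop_nhds_zero_of_lt_one (ENNReal.coe_lt_one_iff.2 hρ1))
      (Or.inr hdiam)
  refine (MeasureTheory.Measure.hausdorffMeasure_le_liminf_sum a A _ htend t
    (.of_forall ht) (.of_forall hcov)).trans ?_
  exact Filter.liminf_le_of_frequently_le' (.of_forall hle)

/-- **Moran's theorem** for a self-similar set with separated pieces. -/
theorem dimH_eq_of_separated_similarities {X : Type*} [EMetricSpace X] {n : ℕ} (hn : 2 ≤ n)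
    {a : ℝ≥0} (ha : 0 < a) {r : Fin n → ℝ≥0} (hr : ∀ i, r i ≠ 0) (hr1 : ∀ i, r i < 1)
    (hsum : ∑ i, r i ^ (a : ℝ) = 1) {f : Fin n → X → X}
    (hf : ∀ i x y, edist (f i x) (f i y) = r i * edist x y)
    {A : Set X} (hA : A.Nonempty) (hAc : IsCompact A) (hdiam : Metric.ediam A ≠ ∞)
    (hself : A = ⋃ i, f i '' A) {g : ℝ≥0∞} (hg0 : g ≠ 0)
    (hg : ∀ i j, i ≠ j → ∀ x ∈ A, ∀ y ∈ A, g ≤ edist (f i x) (f j y)) :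
    dimH A = a := by
  have : Nontrivial (Fin n) := Fin.nontrivial_iff_two_le.2 hn
  borelize X
  have ha' : (0 : ℝ) < a := ha
  have hsum' : ∑ i, (r i : ℝ≥0∞) ^ (a : ℝ) = 1 := by
    simp_rw [← ENNReal.coe_rpow_of_nonneg _ ha'.le]
    exact_mod_cast hsum
  obtain ⟨i₀, hi₀⟩ := Finite.exists_max r
  refine dimH_of_hausdorffMeasure_ne_zero_ne_top (ne_of_gt ?_) (ne_of_lt ?_)
  · refine (ENNReal.rpow_pos_of_nonneg (pos_iff_ne_zero.2 hg0) ha'.le).trans_le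
      (hAc.le_hausdorffMeasure_of_forall_finite_cover ha'
        (rpow_le_sum_ediam_rpow_of_separated ha' hr hsum' (fun i x y ↦ ?_) hA (fun i x hx ↦ ?_) hg))
    · rw [hf, ← mul_assoc, ← ENNReal.coe_mul, inv_mul_cancel₀ (hr i)]
      simp
    · rw [hself]
      exact mem_iUnion.2 ⟨i, x, hx, rfl⟩
  · exact (hausdorffMeasure_le_ediam_rpow_of_subset_iUnion_image ha'.le hsum' (hr1 i₀) hi₀
      (fun i x y ↦ (hf i x y).le) hdiam hself.le).trans_lt
      (ENNReal.rpow_lt_top_of_nonneg ha'.le hdiam)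

/-- The attractor of the modified affine IFS on `[-1,0]` associated to a combination
`(d_1, …, d_n)` (with signs `ε`) has Hausdorff dimension `α_{d_1,…,d_n}`, where
`α_{d_1,…,d_n} ∈ (0,1)` is the unique root of `∑ (1/dᵢ)^α = 1`. -/
theorem dimH_standard_cantor_set (n : ℕ) (hn : 2 ≤ n) (d : Fin n → ℕ)
    (hd : ∀ i, 0 < d i) (hsum : ∑ i, (1 : ℝ) / (d i : ℝ) < 1)
    (α : ℝ) (hα0 : 0 < α) (hα1 : α < 1)
    (hroot : ∑ i, ((1 : ℝ) / (d i : ℝ)) ^ α = 1)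
    (bm bp : Fin n → ℝ)
    (hfirst : bm ⟨0, by omega⟩ = -1) (hlast : bp ⟨n - 1, by omega⟩ = 0)
    (hlen : ∀ i, bp i - bm i = 1 / (d i : ℝ))
    (hlt : ∀ i, bm i < bp i)
    (horder : ∀ i j : Fin n, i < j → bp i < bm j)
    (ε : Fin n → Bool)
    (ψ : Fin n → ℝ → ℝ)
    (hψ : ∀ i x, ψ i x = if ε i then bp i + x / (d i : ℝ) else bm i - x / (d i : ℝ))
    (A : Set ℝ) (hA : A.Nonempty) (hAc : IsCompact A) (hAsub : A ⊆ Icc (-1) 0)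
    (hself : A = ⋃ i, ψ i '' A) :
    dimH A = ENNReal.ofReal α := by
  have hd0 (i : Fin n) : (0 : ℝ) < d i := Nat.cast_pos.2 (hd i)
  have hn0 : 0 < n := by omega
  have hψ_dist (i : Fin n) (x y : ℝ) : dist (ψ i x) (ψ i y) = 1 / d i * dist x y := by
    have hψ_sub : ψ i x - ψ i y = (x - y) / d i ∨ ψ i x - ψ i y = -((x - y) / d i) := by
      simp only [hψ]
      split_ifs
      · left; ring
      · right; ring
    rw [Real.dist_eq, Real.dist_eq, abs_eq_abs.2 hψ_sub, abs_div, abs_of_pos (hd0 i)]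
    ring
  have hψ_mem (i : Fin n) (x : ℝ) (hx : x ∈ A) : bm i ≤ ψ i x ∧ ψ i x ≤ bp i := by
    obtain ⟨hx1, hx0⟩ := hAsub hx
    have hlo : -(1 / (d i : ℝ)) ≤ x / d i := by
      rw [← neg_div]
      exact div_le_div_of_nonneg_right hx1 (hd0 i).le
    have hhi : x / (d i : ℝ) ≤ 0 := div_nonpos_of_nonpos_of_nonneg hx0 (hd0 i).le
    have := hlen i
    rw [hψ]
    split_ifs <;> constructor <;> linarith
  obtain ⟨g, hg0, hg⟩ : ∃ g > 0, ∀ i j : Fin n, i < j → g ≤ bm j - bp i := by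
    have hne : (Finset.univ.filter fun p : Fin n × Fin n ↦ p.1 < p.2).Nonempty :=
      ⟨(⟨0, hn0⟩, ⟨1, by omega⟩), by simp⟩
    obtain ⟨p, hp, hmin⟩ := Finset.exists_min_image _ (fun p ↦ bm p.2 - bp p.1) hne
    exact ⟨_, sub_pos.2 (horder _ _ (Finset.mem_filter.1 hp).2),
      fun i j hij ↦ hmin (i, j) (by simpa using hij)⟩
  have hsep (i j : Fin n) (hij : i ≠ j) (x : ℝ) (hx : x ∈ A) (y : ℝ) (hy : y ∈ A) :
      g ≤ dist (ψ i x) (ψ j y) := by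
    have hi := hψ_mem i x hx
    have hj := hψ_mem j y hy
    rw [Real.dist_eq, le_abs]
    rcases hij.lt_or_gt with h | h
    · right; linarith [hg i j h]
    · left; linarith [hg j i h]
  have hr1 (i : Fin n) : (1 : ℝ) / d i < 1 :=
    (Finset.single_le_sum (f := fun i ↦ (1 : ℝ) / d i)
      (fun j _ ↦ one_div_nonneg.2 (hd0 j).le) (Finset.mem_univ i)).trans_lt hsum
  refine dimH_eq_of_separated_similarities (g := ENNReal.ofReal g)
    (r := fun i ↦ 1 / (d i : ℝ≥0)) hn (Real.toNNReal_pos.2 hα0)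
    (fun i ↦ one_div_ne_zero (Nat.cast_ne_zero.2 (hd i).ne')) (fun i ↦ ?_) ?_ (fun i x y ↦ ?_)
    hA hAc hAc.isBounded.ediam_ne_top hself (ENNReal.ofReal_pos.2 hg0).ne'
    (fun i j hij x hx y hy ↦ ?_)
  · rw [← NNReal.coe_lt_coe]
    simpa using hr1 i
  · rw [← NNReal.coe_inj]
    push_cast
    rw [Real.coe_toNNReal α hα0.le]
    exact hroot
  · rw [edist_dist, hψ_dist, ENNReal.ofReal_mul (one_div_nonneg.2 (hd0 i).le), ← edist_dist]
    congr 1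
    rw [ENNReal.ofReal, ENNReal.coe_inj, ← NNReal.coe_inj,
      Real.coe_toNNReal _ (one_div_nonneg.2 (hd0 i).le)]
    simp
  · rw [edist_dist]
    exact ENNReal.ofReal_le_ofReal (hsep i j hij x hx y hy)
end

section
/- Let Ω be a closed subset of ℝ^N and let ψ_1, …, ψ_m : Ω → Ω (m ≥ 2) satisfy |ψ_i(x) − ψ_i(y)| ≤ c_i |x − y| for all x, y ∈ Ω, where 0 < c_i < 1 for each i. Let J be a nonempty compact subset of Ω with J = ⋃_{i=1}^m ψ_i(J), and let s > 0 be the number satisfying ∑_{i=1}^m c_i^s = 1. Then the Hausdorff dimension of J is at most s. (Theorem 5.3, Falconer's upper-bound criterion for iterated function systems.) -/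
open Set

open MeasureTheory Filter Topology
open scoped NNReal ENNReal

section IteratedFunctionSystem

variable {ι X : Type*}

/-- The image of `J` under the composition `ψ (w 0) ∘ ⋯ ∘ ψ (w (n - 1))`. -/
def iteratedImage (ψ : ι → X → X) (J : Set X) : (n : ℕ) → (Fin n → ι) → Set X
  | 0, _ => J
  | n + 1, w => ψ (w 0) '' iteratedImage ψ J n (Fin.tail w)

variable {ψ : ι → X → X} {J : Set X}

theorem iteratedImage_subset (hself : J = ⋃ i, ψ i '' J) (n : ℕ) (w : Fin n → ι) :
    iteratedImage ψ J n w ⊆ J := by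
  induction n with
  | zero => exact Subset.rfl
  | succ n ih =>
    exact (image_mono (ih _)).trans
      ((subset_iUnion (fun i => ψ i '' J) (w 0)).trans hself.symm.subset)

theorem subset_iUnion_iteratedImage (hself : J = ⋃ i, ψ i '' J) (n : ℕ) :
    J ⊆ ⋃ w, iteratedImage ψ J n w := by
  induction n with
  | zero => exact fun x hx => mem_iUnion.2 ⟨Fin.elim0, hx⟩
  | succ n ih =>
    intro x hx
    rw [hself] at hx
    obtain ⟨i, y, hy, rfl⟩ := mem_iUnion.1 hx
    obtain ⟨w, hw⟩ := mem_iUnion.1 (ih hy)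
    exact mem_iUnion.2 ⟨Fin.cons i w, y, by simpa using hw, by simp⟩

theorem ediam_iteratedImage_le [PseudoEMetricSpace X] {K : ι → ℝ≥0}
    (hK : ∀ i, LipschitzOnWith (K i) (ψ i) J) (hself : J = ⋃ i, ψ i '' J)
    (n : ℕ) (w : Fin n → ι) :
    Metric.ediam (iteratedImage ψ J n w) ≤ (∏ j, K (w j) : ℝ≥0) * Metric.ediam J := by
  induction n with
  | zero => simp [iteratedImage]
  | succ n ih =>
    calc Metric.ediam (iteratedImage ψ J (n + 1) w)
        ≤ K (w 0) * Metric.ediam (iteratedImage ψ J n (Fin.tail w)) :=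
          Metric.ediam_image_le_iff.2 fun x hx y hy =>
            (hK (w 0) (iteratedImage_subset hself n _ hx)
              (iteratedImage_subset hself n _ hy)).trans (by
                gcongr
                exact Metric.edist_le_ediam_of_mem hx hy)
      _ ≤ K (w 0) * ((∏ j, K (Fin.tail w j) : ℝ≥0) * Metric.ediam J) := by
          gcongr
          exact ih _
      _ = (∏ j, K (w j) : ℝ≥0) * Metric.ediam J := by
          rw [Fin.prod_univ_succ, ENNReal.coe_mul, mul_assoc]
          rfl

theorem hausdorffMeasure_attractor_le [Fintype ι] [EMetricSpace X] [MeasurableSpace X]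
    [BorelSpace X] {K : ι → ℝ≥0} (hK : ∀ i, LipschitzOnWith (K i) (ψ i) J)
    (hK1 : ∀ i, K i < 1) (hself : J = ⋃ i, ψ i '' J) (hJ : Metric.ediam J ≠ ∞)
    {s : ℝ} (hs : 0 ≤ s) (hsum : ∑ i, K i ^ s ≤ 1) :
    μH[s] J ≤ Metric.ediam J ^ s := by
  set k : ℝ≥0 := Finset.univ.sup K
  have hk : k < 1 := (Finset.sup_lt_iff one_pos).2 fun i _ => hK1 i
  have hr : Tendsto (fun n : ℕ => (k : ℝ≥0∞) ^ n * Metric.ediam J) atTop (𝓝 0) := by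
    simpa using ENNReal.Tendsto.mul_const
      (ENNReal.tendsto_pow_atTop_nhds_zero_of_lt_one (by exact_mod_cast hk)) (Or.inr hJ)
  refine (Measure.hausdorffMeasure_le_liminf_sum s J _ hr (iteratedImage ψ J)
    (.of_forall fun n w => ?_) (.of_forall (subset_iUnion_iteratedImage hself))).trans ?_
  · refine (ediam_iteratedImage_le hK hself n w).trans ?_
    gcongr
    have : ∏ j, K (w j) ≤ k ^ n := by
      simpa using Finset.prod_le_pow_card Finset.univ (fun j => K (w j)) k
        fun j _ => Finset.le_sup (Finset.mem_univ (w j))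
    exact_mod_cast this
  · refine liminf_le_of_frequently_le' (Frequently.of_forall fun n => ?_)
    calc ∑ w, Metric.ediam (iteratedImage ψ J n w) ^ s
        ≤ ∑ w : Fin n → ι, ((∏ j, K (w j) ^ s : ℝ≥0) : ℝ≥0∞) * Metric.ediam J ^ s := by
          gcongr with w
          rw [NNReal.finsetProd_rpow, ENNReal.coe_rpow_of_nonneg _ hs,
            ← ENNReal.mul_rpow_of_nonneg _ _ hs]
          exact ENNReal.rpow_le_rpow (ediam_iteratedImage_le hK hself n w) hs
      _ = (((∑ i, K i ^ s) ^ n : ℝ≥0) : ℝ≥0∞) * Metric.ediam J ^ s := by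
          rw [← Finset.sum_mul, Fintype.sum_pow, ENNReal.ofNNReal_finsetSum]
      _ ≤ Metric.ediam J ^ s :=
          mul_le_of_le_one_left' (by exact_mod_cast pow_le_one₀ zero_le hsum)

end IteratedFunctionSystem

/-- Theorem 5.3 (Falconer's upper bound): if `ψ_1, …, ψ_m` is an IFS on a closed
set `Ω ⊆ ℝ^N` with contraction ratios `c_i ∈ (0,1)`, `J ⊆ Ω` is a nonempty compact
attractor `J = ⋃ ψ_i(J)`, and `s > 0` satisfies `∑ c_i^s = 1`, then `dimH J ≤ s`. -/
theorem dimH_attractor_le (N m : ℕ) (hm : 2 ≤ m)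
    (Ω : Set (EuclideanSpace ℝ (Fin N))) (hΩ : IsClosed Ω)
    (ψ : Fin m → EuclideanSpace ℝ (Fin N) → EuclideanSpace ℝ (Fin N))
    (hmap : ∀ i, MapsTo (ψ i) Ω Ω)
    (c : Fin m → ℝ) (hc0 : ∀ i, 0 < c i) (hc1 : ∀ i, c i < 1)
    (hlip : ∀ i, ∀ x ∈ Ω, ∀ y ∈ Ω, dist (ψ i x) (ψ i y) ≤ c i * dist x y)
    (J : Set (EuclideanSpace ℝ (Fin N))) (hJ : J.Nonempty) (hJc : IsCompact J)
    (hJΩ : J ⊆ Ω) (hself : J = ⋃ i, ψ i '' J)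
    (s : ℝ) (hs : 0 < s) (hsum : ∑ i, c i ^ s = 1) :
    dimH J ≤ ENNReal.ofReal s := by
  borelize (EuclideanSpace ℝ (Fin N))
  lift c to Fin m → ℝ≥0 using fun i => (hc0 i).le
  lift s to ℝ≥0 using hs.le
  have hK : ∀ i, LipschitzOnWith (c i) (ψ i) J := fun i =>
    LipschitzOnWith.of_dist_le_mul fun x hx y hy => hlip i x (hJΩ hx) y (hJΩ hy)
  have hbdd : Metric.ediam J ≠ ∞ := hJc.isBounded.ediam_ne_top
  rw [ENNReal.ofReal_coe_nnreal]
  refine dimH_le_of_hausdorffMeasure_ne_top (ne_top_of_le_ne_top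
    (ENNReal.rpow_ne_top_of_nonneg s.2 hbdd)
    (hausdorffMeasure_attractor_le hK (fun i => by exact_mod_cast hc1 i) hself hbdd s.2 ?_))
  rw [← NNReal.coe_le_coe]
  push_cast
  exact hsum.le
end

section
/- Let n ≥ 2 and let d_1, …, d_n be positive integers with ∑_{i=1}^n 1/d_i < 1, and let α = α_{d_1,…,d_n}. For each i = 1, …, n let (ε_i(k))_{k∈ℕ} be a sequence of real numbers with ε_i(k) → 0 as k → ∞ and d_i + ε_i(k) > 1 for all k, and let (β(k))_{k∈ℕ} be positive real numbers such that ∑_{i=1}^n d_i · (d_i + ε_i(k))^{−β(k)} = 1 for every k. Then β(k) → 1 + α as k → ∞. (This is the limiting argument at the end of Section 6 showing that the roots β_± of the perturbed Moran equations converge to 1 + α_{d_1,…,d_n}.) -/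
open Filter

/-- For bases greater than one and nonnegative weights, `s ↦ ∑ cᵢ bᵢ ^ (-s)` is antitone. -/
lemma antitone_sum_mul_rpow_neg {ι : Type*} [Fintype ι] {c b : ι → ℝ}
    (hc : ∀ i, 0 ≤ c i) (hb : ∀ i, 1 < b i) :
    Antitone fun s : ℝ => ∑ i, c i * b i ^ (-s) := fun _ _ hst =>
  Finset.sum_le_sum fun i _ => mul_le_mul_of_nonneg_left
    (Real.rpow_le_rpow_of_exponent_le (hb i).le (neg_le_neg hst)) (hc i)

/-- For bases greater than one and positive weights, `s ↦ ∑ cᵢ bᵢ ^ (-s)` is strictly antitone. -/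
lemma strictAnti_sum_mul_rpow_neg {ι : Type*} [Fintype ι] [Nonempty ι] {c b : ι → ℝ}
    (hc : ∀ i, 0 < c i) (hb : ∀ i, 1 < b i) :
    StrictAnti fun s : ℝ => ∑ i, c i * b i ^ (-s) := fun _ _ hst =>
  Finset.sum_lt_sum_of_nonempty Finset.univ_nonempty fun i _ => mul_lt_mul_of_pos_left
    (Real.rpow_lt_rpow_of_exponent_lt (hb i) (neg_lt_neg hst)) (hc i)

/-- Roots of the equations `∑ cᵢ bᵢ(k) ^ (-s) = y` converge to the root of the limiting equation
when the bases converge. -/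
lemma tendsto_of_sum_mul_rpow_neg_eq {ι κ : Type*} [Fintype ι] [Nonempty ι] {l : Filter κ}
    {c b : ι → ℝ} {b' : ι → κ → ℝ} {β : κ → ℝ} {y s₀ : ℝ}
    (hc : ∀ i, 0 < c i) (hb : ∀ i, 1 < b i) (hb' : ∀ i k, 1 < b' i k)
    (hlim : ∀ i, Tendsto (b' i) l (nhds (b i)))
    (hs₀ : ∑ i, c i * b i ^ (-s₀) = y) (hβ : ∀ k, ∑ i, c i * b' i k ^ (-(β k)) = y) :
    Tendsto β l (nhds s₀) := by
  have hF : ∀ s : ℝ, Tendsto (fun k => ∑ i, c i * b' i k ^ (-s)) l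
      (nhds (∑ i, c i * b i ^ (-s))) := fun s =>
    tendsto_finsetSum _ fun i _ => ((hlim i).rpow_const
      (Or.inl (zero_lt_one.trans (hb i)).ne')).const_mul (c i)
  have hmono := strictAnti_sum_mul_rpow_neg hc hb
  have hanti := fun k => antitone_sum_mul_rpow_neg (fun i => (hc i).le) fun i => hb' i k
  refine tendsto_order.2 ⟨fun a ha => ?_, fun a ha => ?_⟩
  · filter_upwards [(hF a).eventually_const_lt (hs₀.symm.trans_lt (hmono ha))] with k hk
    exact (hanti k).reflect_lt ((hβ k).trans_lt hk)
  · filter_upwards [(hF a).eventually_lt_const ((hmono ha).trans_eq hs₀)] with k hk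
    exact (hanti k).reflect_lt (hk.trans_eq (hβ k).symm)

/-- The limiting argument of Section 6: if `α = α_{d_1,…,d_n}` is the root of
`∑ (1/dᵢ)^α = 1`, `ε_i(k) → 0` with `d_i + ε_i(k) > 1`, and `β(k) > 0` satisfies
the perturbed Moran equation `∑ d_i (d_i + ε_i(k))^{-β(k)} = 1` for every `k`,
then `β(k) → 1 + α` as `k → ∞`. -/
theorem perturbed_moran_roots_tendsto (n : ℕ) (hn : 2 ≤ n) (d : Fin n → ℕ)
    (hd : ∀ i, 0 < d i) (hsum : ∑ i, (1 : ℝ) / (d i : ℝ) < 1)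
    (α : ℝ) (hα0 : 0 < α) (hα1 : α < 1)
    (hroot : ∑ i, ((1 : ℝ) / (d i : ℝ)) ^ α = 1)
    (ε : Fin n → ℕ → ℝ) (hε : ∀ i, Tendsto (ε i) atTop (nhds 0))
    (hgt : ∀ i k, 1 < (d i : ℝ) + ε i k)
    (β : ℕ → ℝ) (hβ : ∀ k, 0 < β k)
    (heq : ∀ k, ∑ i, (d i : ℝ) * ((d i : ℝ) + ε i k) ^ (-(β k)) = 1) :
    Tendsto β atTop (nhds (1 + α)) := by
  have : Nonempty (Fin n) := ⟨⟨0, by omega⟩⟩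
  have hpos : ∀ i, (0 : ℝ) < d i := fun i => Nat.cast_pos.2 (hd i)
  have hone : ∀ i, (1 : ℝ) < d i := fun i => by
    have h : (1 : ℝ) / (d i : ℝ) < 1 :=
      (Finset.single_le_sum (f := fun j => (1 : ℝ) / (d j : ℝ))
        (fun j _ => (one_div_pos.2 (hpos j)).le) (Finset.mem_univ i)).trans_lt hsum
    rwa [div_lt_one (hpos i)] at h
  refine tendsto_of_sum_mul_rpow_neg_eq hpos hone hgt
    (fun i => by simpa using (hε i).const_add (d i : ℝ)) ?_ heq
  refine (Finset.sum_congr rfl fun i _ => ?_).trans hroot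
  rw [one_div, Real.inv_rpow (hpos i).le, ← Real.rpow_neg (hpos i).le, neg_add,
    Real.rpow_add (hpos i), Real.rpow_neg_one, mul_inv_cancel_left₀ (hpos i).ne']
end
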